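/- arXiv:0801.2650 — 2 statements merged into one kernel-verified Lean document; each statement's English description precedes it below -/
import Mathlib

section
/- Let σ : (ℝ²,0) → (ℝ²,0) be a C¹ diffeomorphism germ whose derivative at 0 is Dσ(0)(x,y) = (a·x + b·y, c·x + d·y), and let f, g : (ℝ²,0) → (ℝ,0) be real analytic germs, mini-regular in x, with f = g ∘ σ on a neighbourhood of the origin. Let γ : x = λ(y) and γ̃ : x = λ̃(y) be allowable real analytic demi-branches and suppose there exist ξ₀ > 1 and N > 0 with σ(γ) ⊂ H_{ξ₀}(γ̃; N) as germs at the origin. Write λ′(0) for the one-sided derivative of λ at 0 (which exists by allowability). Then c·λ′(0) + d > 0, and for every ξ ∈ (1, ξ₀): if f admits along γ the expansion (e, P) at rate ξ and g admits along γ̃ the expansion (ẽ, Q) at rate ξ, with P and Q nonzero polynomials, then e = ẽ and P(z) = (c·λ′(0) + d)^e · Q( (a·d − b·c)·z / (c·λ′(0) + d)^{ξ+1} ) for all z ∈ ℝ. -/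
open Filter Topology Polynomial

noncomputable section

/-- A C¹ diffeomorphism germ at the origin. -/
def IsC1DiffeoGerm {E : Type*} [NormedAddCommGroup E] [NormedSpace ℝ E] (σ : E → E) : Prop :=
  σ 0 = 0 ∧ ∃ (U V : Set E) (τ : E → E), IsOpen U ∧ IsOpen V ∧ (0 : E) ∈ U ∧ (0 : E) ∈ V ∧
    Set.MapsTo σ U V ∧ Set.MapsTo τ V U ∧ (∀ x ∈ U, τ (σ x) = x) ∧ (∀ y ∈ V, σ (τ y) = y) ∧
    ContDiffOn ℝ 1 σ U ∧ ContDiffOn ℝ 1 τ V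

/-- An allowable real analytic demi-branch `x = λ(y)`, `y ≥ 0`. -/
def AllowableBranch (lam : ℝ → ℝ) : Prop :=
  ∃ (N : ℕ) (μ : ℝ → ℝ), 0 < N ∧ AnalyticAt ℝ μ 0 ∧ μ 0 = 0 ∧
    (∀ᶠ y in 𝓝[≥] (0 : ℝ), lam y = μ (y ^ ((N : ℝ)⁻¹))) ∧
    ∃ C > (0 : ℝ), ∀ᶠ y in 𝓝[≥] (0 : ℝ), |lam y| ≤ C * y

/-- The horn neighbourhood `H_ξ(γ; N)` of the demi-branch `x = λ(y)`. -/
def Horn (ξ : ℝ) (lam : ℝ → ℝ) (N : ℝ) : Set (ℝ × ℝ) :=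
  {p : ℝ × ℝ | 0 < p.2 ∧ |p.1 - lam p.2| ≤ N * p.2 ^ ξ}

/-- `f` admits along the demi-branch `x = λ(y)` the expansion `(e, P)` at rate `ξ`. -/
def AdmitsExpansion (f : ℝ × ℝ → ℝ) (lam : ℝ → ℝ) (ξ e : ℝ) (P : Polynomial ℝ) : Prop :=
  ∀ R > (0 : ℝ), ∀ ε > (0 : ℝ), ∀ᶠ y in 𝓝[>] (0 : ℝ), ∀ z : ℝ, |z| ≤ R →
    |f (lam y + z * y ^ ξ, y) - P.eval z * y ^ e| ≤ ε * y ^ e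

/-- `f` is mini-regular in `x`: its initial homogeneous form does not vanish at `(1,0)`. -/
def MiniRegularInX (f : ℝ × ℝ → ℝ) : Prop :=
  ∃ m : ℕ, (∀ j < m, iteratedFDeriv ℝ j f 0 = 0) ∧
    iteratedFDeriv ℝ m f 0 (fun _ => ((1 : ℝ), (0 : ℝ))) ≠ 0

theorem tendsto_rpow_nhdsGT_zero {r : ℝ} (hr : 0 < r) :
    Tendsto (fun y : ℝ => y ^ r) (𝓝[>] 0) (𝓝 0) := by
  have := (Real.continuousAt_rpow_const 0 r (Or.inr hr.le)).tendsto
  rw [Real.zero_rpow hr.ne'] at this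
  exact this.mono_left nhdsWithin_le_nhds

/-- An analytic function which is `O(s ^ N)` as `s → 0⁺` is divisible by `s ^ N`. -/
theorem AnalyticAt.exists_eq_pow_mul_of_isBigO {μ : ℝ → ℝ} (hμ : AnalyticAt ℝ μ 0) (N : ℕ)
    (h : μ =O[𝓝[>] (0 : ℝ)] fun s => s ^ N) :
    ∃ ν : ℝ → ℝ, AnalyticAt ℝ ν 0 ∧ ∀ᶠ s in 𝓝 (0 : ℝ), μ s = s ^ N * ν s := by
  by_cases hz : ∀ᶠ s in 𝓝 (0 : ℝ), μ s = 0
  · exact ⟨fun _ => 0, analyticAt_const, by simpa using hz⟩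
  obtain ⟨n, ν, hν, hν0, hev⟩ := hμ.exists_eventuallyEq_pow_smul_nonzero_iff.mpr hz
  simp only [sub_zero, smul_eq_mul] at hev
  have hNn : N ≤ n := by
    by_contra! hlt
    obtain ⟨C, hC⟩ := h.bound
    have hlim : Tendsto (fun s : ℝ => C * s ^ (N - n)) (𝓝[>] 0) (𝓝 0) := by
      have : Tendsto (fun s : ℝ => C * s ^ (N - n)) (𝓝 0) (𝓝 (C * 0 ^ (N - n))) :=
        (by fun_prop : Continuous fun s : ℝ => C * s ^ (N - n)).tendsto 0
      rw [zero_pow (by omega), mul_zero] at this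
      exact this.mono_left nhdsWithin_le_nhds
    have hν_lim : Tendsto (fun s => |ν s|) (𝓝[>] 0) (𝓝 |ν 0|) :=
      (hν.continuousAt.tendsto.mono_left nhdsWithin_le_nhds).abs
    refine (abs_pos.mpr hν0).not_ge (le_of_tendsto_of_tendsto hν_lim hlim ?_)
    filter_upwards [hC, hev.filter_mono nhdsWithin_le_nhds, self_mem_nhdsWithin] with s h1 h2 h3
    have hs : (0 : ℝ) < s := h3
    rw [h2, Real.norm_eq_abs, Real.norm_eq_abs, abs_mul, abs_of_pos (pow_pos hs n),
      abs_of_pos (pow_pos hs N), ← Nat.sub_add_cancel hlt.le, pow_add] at h1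
    have := pow_pos hs n
    refine le_of_mul_le_mul_left ?_ this
    linarith
  refine ⟨fun s => s ^ (n - N) * ν s, (analyticAt_id.pow _).mul hν, ?_⟩
  filter_upwards [hev] with s hs
  rw [hs, ← mul_assoc, ← pow_add, Nat.add_sub_cancel' hNn]

/-- A function on the right of `0` whose derivative has a limit at `0⁺` is strictly
differentiable from the right at `0`. -/
theorem isLittleO_sub_of_tendsto_deriv_nhdsGT {φ F : ℝ → ℝ} {m : ℝ}
    (hd : ∀ᶠ y in 𝓝[>] (0 : ℝ), HasDerivAt φ (F y) y) (hF : Tendsto F (𝓝[>] 0) (𝓝 m)) :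
    (fun p : ℝ × ℝ => φ p.1 - φ p.2 - m * (p.1 - p.2))
      =o[𝓝[>] (0 : ℝ) ×ˢ 𝓝[>] (0 : ℝ)] fun p => p.1 - p.2 := by
  rw [Asymptotics.isLittleO_iff]
  intro ε hε
  obtain ⟨δ, hδ0, hδ⟩ := mem_nhdsGT_iff_exists_Ioo_subset.mp
    (hd.and (hF (Metric.closedBall_mem_nhds m hε)))
  have hI : Set.Ioo 0 δ ∈ 𝓝[>] (0 : ℝ) := Ioo_mem_nhdsGT hδ0
  filter_upwards [prod_mem_prod hI hI] with p hp
  have := Convex.norm_image_sub_le_of_norm_hasDerivWithin_le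
    (f := fun y => φ y - m * y) (f' := fun y => F y - m) (s := Set.Ioo 0 δ) (C := ε)
    (fun y hy => by
      have h1 := (hδ hy).1.sub ((hasDerivAt_id y).const_mul m)
      rw [mul_one] at h1
      exact h1.hasDerivWithinAt)
    (fun y hy => by simpa [dist_eq_norm] using (hδ hy).2) (convex_Ioo 0 δ) hp.2 hp.1
  refine le_of_eq_of_le (congrArg _ ?_) this
  ring

/-- An allowable demi-branch is `C¹` up to its end point. -/
theorem AllowableBranch.exists_strict_deriv {lam : ℝ → ℝ} (h : AllowableBranch lam) :
    ∃ m : ℝ, Tendsto (fun y => lam y / y) (𝓝[>] 0) (𝓝 m) ∧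
      (fun p : ℝ × ℝ => lam p.1 - lam p.2 - m * (p.1 - p.2))
        =o[𝓝[>] (0 : ℝ) ×ˢ 𝓝[>] (0 : ℝ)] fun p => p.1 - p.2 := by
  obtain ⟨N, μ, hN, hμ, -, hlam, C, -, hC⟩ := h
  have hNi : 0 < (N : ℝ)⁻¹ := by positivity
  have hroot : Tendsto (fun y : ℝ => y ^ (N : ℝ)⁻¹) (𝓝[>] 0) (𝓝 0) :=
    tendsto_rpow_nhdsGT_zero hNi
  have hpow : Tendsto (fun s : ℝ => s ^ N) (𝓝[>] 0) (𝓝[≥] 0) := by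
    refine tendsto_nhdsWithin_iff.mpr ⟨?_, ?_⟩
    · have := (continuous_pow (M := ℝ) N).tendsto 0
      rw [zero_pow hN.ne'] at this
      exact this.mono_left nhdsWithin_le_nhds
    · filter_upwards [self_mem_nhdsWithin] with s hs
      exact pow_nonneg (le_of_lt (Set.mem_Ioi.mp hs)) N
  have hO : μ =O[𝓝[>] (0 : ℝ)] fun s => s ^ N := by
    refine Asymptotics.IsBigO.of_bound C ?_
    filter_upwards [hpow.eventually hlam, hpow.eventually hC, self_mem_nhdsWithin] with s h1 h2 h3
    have hs : (0 : ℝ) < s := h3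
    rw [h1, Real.pow_rpow_inv_natCast hs.le hN.ne'] at h2
    rwa [Real.norm_eq_abs, Real.norm_eq_abs, abs_of_pos (pow_pos hs N)]
  obtain ⟨ν, hν, hμν⟩ := hμ.exists_eq_pow_mul_of_isBigO N hO
  have hlamν : ∀ᶠ y in 𝓝[>] (0 : ℝ), lam y = y * ν (y ^ (N : ℝ)⁻¹) := by
    filter_upwards [hlam.filter_mono (nhdsWithin_mono 0 Set.Ioi_subset_Ici_self),
      hroot.eventually hμν, self_mem_nhdsWithin] with y h1 h2 h3
    rw [h1, h2, Real.rpow_inv_natCast_pow (le_of_lt h3) hN.ne']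
  refine ⟨ν 0, ?_, ?_⟩
  · refine (hν.continuousAt.tendsto.comp hroot).congr' ?_
    filter_upwards [hlamν, self_mem_nhdsWithin] with y h1 h2
    have hy : y ≠ 0 := ne_of_gt h2
    rw [h1, mul_div_cancel_left₀ _ hy, Function.comp]
  · refine isLittleO_sub_of_tendsto_deriv_nhdsGT
      (F := fun y => ν (y ^ (N : ℝ)⁻¹) + deriv ν (y ^ (N : ℝ)⁻¹) * ((N : ℝ)⁻¹ * y ^ (N : ℝ)⁻¹))
      ?_ ?_
    · filter_upwards [eventually_eventually_nhdsWithin.mpr hlamν,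
        hroot.eventually hν.eventually_analyticAt, self_mem_nhdsWithin] with y h1 h2 h3
      have hy : (0 : ℝ) < y := h3
      rw [IsOpen.nhdsWithin_eq isOpen_Ioi h3] at h1
      have hd := (hasDerivAt_id y).mul (h2.differentiableAt.hasDerivAt.comp y
        (Real.hasDerivAt_rpow_const (p := (N : ℝ)⁻¹) (Or.inl hy.ne')))
      refine (hd.congr_of_eventuallyEq h1).congr_deriv ?_
      have : y ^ (N : ℝ)⁻¹ = y * y ^ ((N : ℝ)⁻¹ - 1) := by
        rw [Real.rpow_sub_one hy.ne', mul_div_cancel₀ _ hy.ne']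
      simp only [Function.comp, id, one_mul]
      linear_combination (-(deriv ν (y ^ (N : ℝ)⁻¹) * (N : ℝ)⁻¹)) * this
    · have h1 := hν.continuousAt.tendsto.comp hroot
      have h2 := hν.deriv.continuousAt.tendsto.comp hroot
      simpa using h1.add (h2.mul (hroot.const_mul (N : ℝ)⁻¹))

/-- An allowable demi-branch starts at the origin. -/
theorem AllowableBranch.apply_zero {lam : ℝ → ℝ} (h : AllowableBranch lam) : lam 0 = 0 := by
  obtain ⟨N, μ, hN, -, hμ0, hlam, -⟩ := h
  have hN0 : (N : ℝ)⁻¹ ≠ 0 := by positivity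
  rw [hlam.self_of_nhdsWithin Set.self_mem_Ici, Real.zero_rpow hN0, hμ0]

/-- The derivative at the origin of a C¹ diffeomorphism germ is injective. -/
theorem IsC1DiffeoGerm.fderiv_injective {E : Type*} [NormedAddCommGroup E] [NormedSpace ℝ E]
    {σ : E → E} (h : IsC1DiffeoGerm σ) : Function.Injective (fderiv ℝ σ 0) := by
  obtain ⟨h0, U, V, τ, hU, hV, hU0, hV0, -, -, hτσ, -, hσd, hτd⟩ := h
  have h1 := ((hσd.contDiffAt (hU.mem_nhds hU0)).differentiableAt one_ne_zero).hasFDerivAt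
  have h2 := ((hτd.contDiffAt (hV.mem_nhds hV0)).differentiableAt one_ne_zero).hasFDerivAt
  rw [← h0] at h2
  have h3 := (h2.comp 0 h1).congr_of_eventuallyEq (f₁ := id)
    (by filter_upwards [hU.mem_nhds hU0] with x hx using (hτσ x hx).symm)
  have h4 := h3.unique (hasFDerivAt_id 0)
  intro v w hvw
  have h5 := fun v => DFunLike.congr_fun h4 v
  simp only [ContinuousLinearMap.comp_apply, ContinuousLinearMap.id_apply] at h5
  rw [← h5 v, ← h5 w, hvw]

theorem IsC1DiffeoGerm.hasStrictFDerivAt {E : Type*} [NormedAddCommGroup E] [NormedSpace ℝ E]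
    {σ : E → E} (h : IsC1DiffeoGerm σ) : HasStrictFDerivAt σ (fderiv ℝ σ 0) 0 := by
  obtain ⟨-, U, -, -, hU, -, hU0, -, -, -, -, -, hσd, -⟩ := h
  exact (hσd.contDiffAt (hU.mem_nhds hU0)).hasStrictFDerivAt one_ne_zero

/-- Uniform expansions along a branch restrict to moving parameters. -/
theorem AdmitsExpansion.tendsto_div {f : ℝ × ℝ → ℝ} {lam : ℝ → ℝ} {ξ e : ℝ} {P : Polynomial ℝ}
    (h : AdmitsExpansion f lam ξ e P) {α : Type*} {l : Filter α} {u w : α → ℝ} {w₀ : ℝ}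
    (hu : Tendsto u l (𝓝[>] 0)) (hw : Tendsto w l (𝓝 w₀)) :
    Tendsto (fun t => f (lam (u t) + w t * u t ^ ξ, u t) / u t ^ e) l (𝓝 (P.eval w₀)) := by
  have hP : Tendsto (fun t => P.eval (w t)) l (𝓝 (P.eval w₀)) :=
    (P.continuous.tendsto w₀).comp hw
  have hdiff : Tendsto (fun t => f (lam (u t) + w t * u t ^ ξ, u t) / u t ^ e - P.eval (w t)) l
      (𝓝 0) := by
    rw [Metric.tendsto_nhds]
    intro ε hε
    have hbd : ∀ᶠ t in l, |w t| ≤ |w₀| + 1 :=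
      (hw.abs.eventually (gt_mem_nhds (lt_add_one _))).mono fun _ h => le_of_lt h
    filter_upwards [hu.eventually (h (|w₀| + 1) (by positivity) (ε / 2) (by positivity)), hbd,
      hu.eventually self_mem_nhdsWithin] with t h1 h2 h3
    have hpos : 0 < u t ^ e := Real.rpow_pos_of_pos h3 e
    rw [Real.dist_eq, sub_zero, div_sub' hpos.ne', abs_div, abs_of_pos hpos, div_lt_iff₀ hpos,
      mul_comm (u t ^ e)]
    refine (h1 _ h2).trans_lt ?_
    nlinarith
  simpa using hdiff.add hP

/-- A limit after division by `y ^ s` forces the limit `0` after division by a lower power. -/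
theorem tendsto_div_rpow_of_lt {φ : ℝ → ℝ} {r s A : ℝ} (hrs : r < s)
    (h : Tendsto (fun y => φ y / y ^ s) (𝓝[>] 0) (𝓝 A)) :
    Tendsto (fun y => φ y / y ^ r) (𝓝[>] 0) (𝓝 0) := by
  have := h.mul (tendsto_rpow_nhdsGT_zero (sub_pos.mpr hrs))
  rw [mul_zero] at this
  refine this.congr' ?_
  filter_upwards [self_mem_nhdsWithin] with y hy
  have hy : (0 : ℝ) < y := hy
  have h1 := Real.rpow_pos_of_pos hy s
  have h2 := Real.rpow_pos_of_pos hy r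
  rw [Real.rpow_sub hy]
  field_simp

/-- The transformation rule of the coefficient polynomials under an arbitrary C¹
equivalence with `Dσ(0)(x,y) = (ax+by, cx+dy)`. -/
theorem stmt11 (σ : ℝ × ℝ → ℝ × ℝ) (hσ : IsC1DiffeoGerm σ) (a b c d : ℝ)
    (hDσ : ∀ v : ℝ × ℝ, fderiv ℝ σ 0 v = (a * v.1 + b * v.2, c * v.1 + d * v.2))
    (f g : ℝ × ℝ → ℝ) (hfa : AnalyticAt ℝ f 0) (hga : AnalyticAt ℝ g 0)
    (hf0 : f 0 = 0) (hg0 : g 0 = 0)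
    (hfm : MiniRegularInX f) (hgm : MiniRegularInX g)
    (hfg : ∀ᶠ p in 𝓝 (0 : ℝ × ℝ), f p = g (σ p))
    (lam lam' : ℝ → ℝ) (hγ : AllowableBranch lam) (hγ' : AllowableBranch lam')
    (ξ₀ N : ℝ) (hξ₀ : 1 < ξ₀) (hN : 0 < N)
    (hincl : ∀ᶠ y in 𝓝[>] (0 : ℝ), σ (lam y, y) ∈ Horn ξ₀ lam' N)
    (lamd : ℝ) (hlamd : HasDerivWithinAt lam lamd (Set.Ici (0 : ℝ)) 0) :
    0 < c * lamd + d ∧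
      ∀ ξ : ℝ, 1 < ξ → ξ < ξ₀ → ∀ (e e' : ℝ) (P Q : Polynomial ℝ), P ≠ 0 → Q ≠ 0 →
        AdmitsExpansion f lam ξ e P → AdmitsExpansion g lam' ξ e' Q →
        e = e' ∧ ∀ z : ℝ,
          P.eval z = (c * lamd + d) ^ e *
            Q.eval ((a * d - b * c) * z / (c * lamd + d) ^ (ξ + 1)) := by
  have hlam0 := hγ.apply_zero
  have hS := hσ.hasStrictFDerivAt
  have hσ0 : σ 0 = 0 := hσ.1
  obtain ⟨m, hm, hstrict⟩ := hγ'.exists_strict_deriv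
  have hinj : ∀ v : ℝ × ℝ, a * v.1 + b * v.2 = 0 → c * v.1 + d * v.2 = 0 → v = 0 := by
    intro v h1 h2
    apply hσ.fderiv_injective
    rw [hDσ, h1, h2, map_zero, Prod.zero_eq_mk]
  have hdet : a * d - b * c ≠ 0 := by
    intro hdet
    have h1 := hinj (d, -c) (by simpa using by linarith) (by simpa using by ring)
    have h2 := hinj (b, -a) (by simpa using by ring) (by simpa using by linarith)
    simp only [Prod.mk_eq_zero, neg_eq_zero] at h1 h2
    have h3 := hinj (1, 0) (by simp [h2]) (by simp [h1])
    simp at h3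
  have hid : Tendsto (fun y : ℝ => y) (𝓝[>] 0) (𝓝 0) := tendsto_id.mono_left nhdsWithin_le_nhds
  have hlim0 : Tendsto lam (𝓝[>] 0) (𝓝 0) := by
    have := hlamd.continuousWithinAt.tendsto
    rw [hlam0] at this
    exact this.mono_left (nhdsWithin_mono 0 Set.Ioi_subset_Ici_self)
  have hbase : Tendsto (fun y => (lam y, y)) (𝓝[>] 0) (𝓝 (0 : ℝ × ℝ)) :=
    hlim0.prodMk_nhds hid
  have hYpos : ∀ᶠ y in 𝓝[>] (0 : ℝ), 0 < (σ (lam y, y)).2 := hincl.mono fun _ h => h.1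
  have hslope : Tendsto (fun y => y⁻¹ • σ (lam y, y)) (𝓝[>] 0)
      (𝓝 (a * lamd + b, c * lamd + d)) := by
    have h1 : HasDerivWithinAt (fun y => (lam y, y)) (lamd, (1 : ℝ)) (Set.Ioi 0) 0 :=
      (hlamd.mono Set.Ioi_subset_Ici_self).prodMk (hasDerivWithinAt_id 0 _)
    have h2 : HasFDerivAt σ (fderiv ℝ σ 0) (lam 0, 0) := by
      rw [hlam0]
      exact hS.hasFDerivAt
    have h3 := HasFDerivAt.comp_hasDerivWithinAt (f := fun y => (lam y, y)) 0 h2 h1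
    rw [hasDerivWithinAt_iff_tendsto_slope' Set.self_notMem_Ioi, hDσ] at h3
    simpa [slope_fun_def, Function.comp_def, hlam0, ← Prod.zero_eq_mk, hσ0] using h3
  have hX0 : Tendsto (fun y => (σ (lam y, y)).1 / y) (𝓝[>] 0) (𝓝 (a * lamd + b)) := by
    simpa [div_eq_inv_mul] using hslope.fst_nhds
  have hY0 : Tendsto (fun y => (σ (lam y, y)).2 / y) (𝓝[>] 0) (𝓝 (c * lamd + d)) := by
    simpa [div_eq_inv_mul] using hslope.snd_nhds
  have hσbase : Tendsto (fun y => σ (lam y, y)) (𝓝[>] 0) (𝓝 0) := by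
    have := hS.continuousAt.tendsto.comp hbase
    rwa [hσ0] at this
  have hY0_lim : Tendsto (fun y => (σ (lam y, y)).2) (𝓝[>] 0) (𝓝[>] 0) :=
    tendsto_nhdsWithin_iff.mpr ⟨hσbase.snd_nhds, hYpos⟩
  have hgap : ∀ r : ℝ, r < ξ₀ →
      Tendsto (fun y => ((σ (lam y, y)).1 - lam' (σ (lam y, y)).2) / y ^ r) (𝓝[>] 0) (𝓝 0) := by
    intro r hr
    have h1 : Tendsto (fun y => N * ((σ (lam y, y)).2 / y) ^ ξ₀ * y ^ (ξ₀ - r)) (𝓝[>] 0) (𝓝 0) := by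
      have := ((hY0.rpow_const (p := ξ₀) (Or.inr (by linarith))).const_mul N).mul
        (tendsto_rpow_nhdsGT_zero (sub_pos.mpr hr))
      rwa [mul_zero] at this
    refine squeeze_zero_norm' ?_ h1
    filter_upwards [hincl, self_mem_nhdsWithin] with y h2 h3
    have hy : (0 : ℝ) < y := h3
    have hyr := Real.rpow_pos_of_pos hy r
    have hyξ := Real.rpow_pos_of_pos hy ξ₀
    rw [norm_div, Real.norm_eq_abs, Real.norm_eq_abs, abs_of_pos hyr, div_le_iff₀ hyr]
    refine h2.2.trans (le_of_eq ?_)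
    rw [Real.div_rpow h2.1.le hy.le, Real.rpow_sub hy]
    field_simp
  have hL : a * lamd + b = m * (c * lamd + d) := by
    have h1 : Tendsto (fun y => lam' (σ (lam y, y)).2 / y) (𝓝[>] 0) (𝓝 (m * (c * lamd + d))) := by
      refine ((hm.comp hY0_lim).mul hY0).congr' ?_
      filter_upwards [hYpos] with y hy
      simp only [Function.comp]
      field_simp
    have h2 := hX0.sub h1
    have h3 := hgap 1 hξ₀
    simp only [Real.rpow_one, sub_div] at h3
    exact sub_eq_zero.mp (tendsto_nhds_unique h2 h3)
  have hK : 0 < c * lamd + d := by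
    refine lt_of_le_of_ne (ge_of_tendsto hY0 ?_) fun h => ?_
    · filter_upwards [hYpos, self_mem_nhdsWithin] with y h1 h2
      exact (div_pos h1 h2).le
    · rw [← h, mul_zero] at hL
      simpa using hinj (lamd, 1) (by simpa using hL) (by simpa using h.symm)
  refine ⟨hK, fun ξ hξ1 hξ e e' P Q hP0 hQ0 hP hQ => ?_⟩
  set K := c * lamd + d with hKdef
  have hξ0 : Tendsto (fun y : ℝ => y ^ ξ) (𝓝[>] 0) (𝓝 0) := tendsto_rpow_nhdsGT_zero (by linarith)
  have hkey : ∀ z : ℝ, Tendsto (fun y => f (lam y + z * y ^ ξ, y) / y ^ e') (𝓝[>] 0)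
      (𝓝 (K ^ e' * Q.eval ((a * d - b * c) * z / K ^ (ξ + 1)))) := by
    intro z
    have hp : Tendsto (fun y => (lam y + z * y ^ ξ, y)) (𝓝[>] 0) (𝓝 (0 : ℝ × ℝ)) := by
      have := (hlim0.add (hξ0.const_mul z)).prodMk_nhds hid
      simpa [Prod.zero_eq_mk] using this
    have hinc : Tendsto
        (fun y => (y ^ ξ)⁻¹ • (σ (lam y + z * y ^ ξ, y) - σ (lam y, y))) (𝓝[>] 0)
        (𝓝 (a * z, c * z)) := by
      have h1 := hS.isLittleO.comp_tendsto (hp.prodMk_nhds hbase)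
      have h2 : (fun y : ℝ => ((lam y + z * y ^ ξ, y) : ℝ × ℝ) - (lam y, y)) =O[𝓝[>] 0]
          fun y => y ^ ξ := by
        refine Asymptotics.IsBigO.of_bound |z| (Eventually.of_forall fun y => ?_)
        simp [Prod.norm_def]
        positivity
      have h3 := (h1.trans_isBigO h2).tendsto_inv_smul_nhds_zero
      have h4 := h3.add_const (a * z, c * z)
      rw [zero_add] at h4
      refine h4.congr' ?_
      filter_upwards [self_mem_nhdsWithin] with y hy
      have hyξ := (Real.rpow_pos_of_pos (Set.mem_Ioi.mp hy) ξ).ne'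
      simp only [Function.comp, hDσ]
      ext
      · simp
        field_simp
        ring
      · simp
        field_simp
        ring
    set X : ℝ → ℝ := fun y => (σ (lam y + z * y ^ ξ, y)).1
    set Y : ℝ → ℝ := fun y => (σ (lam y + z * y ^ ξ, y)).2
    set X₀ : ℝ → ℝ := fun y => (σ (lam y, y)).1
    set Y₀ : ℝ → ℝ := fun y => (σ (lam y, y)).2
    have hXd : Tendsto (fun y => (X y - X₀ y) / y ^ ξ) (𝓝[>] 0) (𝓝 (a * z)) := by
      simpa [div_eq_inv_mul] using hinc.fst_nhds
    have hYd : Tendsto (fun y => (Y y - Y₀ y) / y ^ ξ) (𝓝[>] 0) (𝓝 (c * z)) := by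
      simpa [div_eq_inv_mul] using hinc.snd_nhds
    have hYy : Tendsto (fun y => Y y / y) (𝓝[>] 0) (𝓝 K) := by
      have h1 := tendsto_div_rpow_of_lt hξ1 hYd
      have h2 := h1.add hY0
      rw [zero_add] at h2
      refine h2.congr fun y => ?_
      rw [Real.rpow_one, ← add_div, sub_add_cancel]
    have hYpos' : ∀ᶠ y in 𝓝[>] (0 : ℝ), 0 < Y y := by
      filter_upwards [hYy.eventually (lt_mem_nhds hK), self_mem_nhdsWithin] with y h1 h2
      exact (div_pos_iff_of_pos_right h2).mp h1
    have hY_lim : Tendsto Y (𝓝[>] 0) (𝓝[>] 0) := by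
      refine tendsto_nhdsWithin_iff.mpr ⟨?_, hYpos'⟩
      have := hS.continuousAt.tendsto.comp hp
      rw [hσ0] at this
      exact this.snd_nhds
    have hlamY : Tendsto (fun y => (lam' (Y y) - lam' (Y₀ y)) / y ^ ξ) (𝓝[>] 0)
        (𝓝 (m * (c * z))) := by
      have h1 := hstrict.comp_tendsto (hY_lim.prodMk hY0_lim)
      have h2 : (fun y => Y y - Y₀ y) =O[𝓝[>] 0] fun y => y ^ ξ := by
        refine Asymptotics.isBigO_of_div_tendsto_nhds ?_ _ hYd
        filter_upwards [self_mem_nhdsWithin] with y hy h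
        exact absurd h (Real.rpow_pos_of_pos hy ξ).ne'
      have h3 := (h1.trans_isBigO h2).tendsto_div_nhds_zero
      have h4 := h3.add (hYd.const_mul m)
      rw [zero_add] at h4
      refine h4.congr fun y => ?_
      simp only [Function.comp]
      ring
    have hw : Tendsto (fun y => (X y - lam' (Y y)) / Y y ^ ξ) (𝓝[>] 0)
        (𝓝 ((a * d - b * c) * z / K ^ (ξ + 1))) := by
      have h1 := (hXd.sub hlamY).add (hgap ξ hξ)
      have h2 := h1.div (hYy.rpow_const (p := ξ) (Or.inl hK.ne'))
        (Real.rpow_pos_of_pos hK ξ).ne'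
      have h3 : (a * z - m * (c * z) + 0) / K ^ ξ = (a * d - b * c) * z / K ^ (ξ + 1) := by
        have hKξ := Real.rpow_pos_of_pos hK ξ
        have : a * d - b * c = (a - m * c) * K := by
          linear_combination (-c) * hL + a * hKdef
        rw [Real.rpow_add_one hK.ne', this]
        field_simp
        ring
      rw [h3] at h2
      refine h2.congr' ?_
      filter_upwards [hYpos', self_mem_nhdsWithin] with y h4 h5
      have hy : (0 : ℝ) < y := h5
      have := Real.rpow_pos_of_pos hy ξ
      have := Real.rpow_pos_of_pos h4 ξ
      rw [Pi.div_apply, Real.div_rpow h4.le hy.le]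
      field_simp
      ring
    have hg := (hQ.tendsto_div hY_lim hw).mul (hYy.rpow_const (p := e') (Or.inl hK.ne'))
    rw [mul_comm (K ^ e')]
    refine hg.congr' ?_
    filter_upwards [hYpos', self_mem_nhdsWithin, hp.eventually hfg] with y h1 h2 h3
    have hy : (0 : ℝ) < y := h2
    have := Real.rpow_pos_of_pos hy e'
    have := Real.rpow_pos_of_pos h1 e'
    have := Real.rpow_pos_of_pos h1 ξ
    rw [h3, Real.div_rpow h1.le hy.le, div_mul_cancel₀ _ this.ne', add_sub_cancel]
    change g (X y, Y y) / Y y ^ e' * (Y y ^ e' / y ^ e') = g (X y, Y y) / y ^ e'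
    field_simp
  have hPlim : ∀ z : ℝ, Tendsto (fun y => f (lam y + z * y ^ ξ, y) / y ^ e) (𝓝[>] 0)
      (𝓝 (P.eval z)) := fun z => hP.tendsto_div tendsto_id tendsto_const_nhds
  have hKe' := (Real.rpow_pos_of_pos hK e').ne'
  have hKξ := (Real.rpow_pos_of_pos hK (ξ + 1)).ne'
  have hee' : e = e' := by
    rcases lt_trichotomy e e' with hlt | heq | hlt
    · refine absurd (Polynomial.funext fun z => ?_) hP0
      rw [tendsto_nhds_unique (hPlim z) (tendsto_div_rpow_of_lt hlt (hkey z)), eval_zero]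
    · exact heq
    · refine absurd (Polynomial.funext fun w => ?_) hQ0
      have := tendsto_nhds_unique (hkey (K ^ (ξ + 1) * w / (a * d - b * c)))
        (tendsto_div_rpow_of_lt hlt (hPlim _))
      rw [mul_div_cancel₀ _ hdet, mul_div_cancel_left₀ _ hKξ] at this
      simpa [hKe'] using this
  subst hee'
  exact ⟨rfl, fun z => tendsto_nhds_unique (hPlim z) (hkey z)⟩
end
end

section
/- Let p, q be integers with 1 < p < q and gcd(p, q) = 1, and let f, g ∈ ℝ[x,y] be nonzero polynomials that are weighted homogeneous with respect to the weights (q, p) (every monomial x^i y^j of f satisfies q·i + p·j = d_f for some fixed d_f, and similarly for g). Assume that neither f nor g is a monomial, i.e. neither can be written in the form A·x^k·y^l with A ∈ ℝ and k, l ∈ ℕ. If there exists a C¹ diffeomorphism germ σ : (ℝ²,0) → (ℝ²,0) with f = g ∘ σ on a neighbourhood of the origin, then there exist real numbers c₁ ≠ 0 and c₂ ≠ 0 such that f(x, y) = g(c₁·x, c₂·y) for all (x, y) ∈ ℝ². -/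
open Filter Topology

noncomputable section

/-- The quasi-homogeneous form with terms `a k * x ^ (m - p * k) * y ^ (b + q * k)`. -/
def quasiForm (p q m b : ℕ) (a : ℕ → ℝ) (x y : ℝ) : ℝ :=
  ∑ k ∈ Finset.range (m / p + 1), a k * x ^ (m - p * k) * y ^ (b + q * k)

/-- The polynomial with terms `a k * X ^ (m - p * k)`. -/
def gapPoly (p m : ℕ) (a : ℕ → ℝ) : Polynomial ℝ :=
  ∑ k ∈ Finset.range (m / p + 1), Polynomial.monomial (m - p * k) (a k)

lemma mul_le_of_mem_range_div {p m k : ℕ} (hk : k ∈ Finset.range (m / p + 1)) : p * k ≤ m :=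
  (Nat.mul_le_mul_left p (Nat.lt_succ_iff.mp (Finset.mem_range.mp hk))).trans
    (Nat.mul_div_le m p)

lemma quasiForm_eq_eval (p q m b : ℕ) (a : ℕ → ℝ) (x y : ℝ) :
    quasiForm p q m b a x y = (gapPoly p m fun k => a k * y ^ (b + q * k)).eval x := by
  simp only [quasiForm, gapPoly, Polynomial.eval_finsetSum, Polynomial.eval_monomial]
  exact Finset.sum_congr rfl fun k _ => by ring

lemma gapPoly_coeff {p m k : ℕ} (hp : 0 < p) (a : ℕ → ℝ) (hk : k ∈ Finset.range (m / p + 1)) :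
    (gapPoly p m a).coeff (m - p * k) = a k := by
  simp only [gapPoly, Polynomial.finsetSum_coeff, Polynomial.coeff_monomial]
  rw [Finset.sum_eq_single k, if_pos rfl]
  · intro j hj hjk
    rw [if_neg]
    intro h
    have h1 := mul_le_of_mem_range_div hj
    have h2 := mul_le_of_mem_range_div hk
    exact hjk (Nat.eq_of_mul_eq_mul_left hp (by omega))
  · exact fun h => absurd hk h

lemma gapPoly_coeff_top {p m : ℕ} (hp : 0 < p) (a : ℕ → ℝ) : (gapPoly p m a).coeff m = a 0 := by
  simpa using gapPoly_coeff (m := m) (k := 0) hp a (by simp)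

lemma gapPoly_coeff_pred {p m : ℕ} (hp : 1 < p) (hm : 0 < m) (a : ℕ → ℝ) :
    (gapPoly p m a).coeff (m - 1) = 0 := by
  simp only [gapPoly, Polynomial.finsetSum_coeff, Polynomial.coeff_monomial]
  refine Finset.sum_eq_zero fun k hk => if_neg fun h => ?_
  have h1 := mul_le_of_mem_range_div hk
  rcases Nat.eq_zero_or_pos k with rfl | hk0
  · omega
  · have : p * 1 ≤ p * k := Nat.mul_le_mul_left p hk0
    omega

lemma gapPoly_natDegree_le (p m : ℕ) (a : ℕ → ℝ) : (gapPoly p m a).natDegree ≤ m :=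
  Polynomial.natDegree_sum_le_of_forall_le _ _ fun _ _ =>
    (Polynomial.natDegree_monomial_le _).trans (Nat.sub_le _ _)

lemma quasiForm_smul {p q m b : ℕ} (a : ℕ → ℝ) (t x y : ℝ) :
    quasiForm p q m b a (t ^ q * x) (t ^ p * y) =
      t ^ (q * m + p * b) * quasiForm p q m b a x y := by
  simp only [quasiForm, Finset.mul_sum]
  refine Finset.sum_congr rfl fun k hk => ?_
  obtain ⟨r, hr⟩ := Nat.exists_eq_add_of_le (mul_le_of_mem_range_div hk)
  rw [show m - p * k = r by omega, hr]
  ring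

/-- A polynomial with vanishing subleading coefficient keeps this property under an affine
substitution only if the substitution is linear. -/
lemma eq_zero_of_eval_affine {P Q : Polynomial ℝ} {m : ℕ} {c α : ℝ} (hm : 0 < m) (hc : c ≠ 0)
    (hP : P.coeff (m - 1) = 0) (hQ : Q.coeff (m - 1) = 0) (hQm : Q.coeff m ≠ 0)
    (hQd : Q.natDegree ≤ m) (h : ∀ s, P.eval s = Q.eval (α + c * s)) : α = 0 := by
  have hPQ : P = (Polynomial.taylor α Q).comp (Polynomial.C c * Polynomial.X) := by
    refine Polynomial.funext fun s => ?_
    simp [h, Polynomial.taylor_apply, add_comm]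
  have h0 : (Polynomial.taylor α Q).coeff (m - 1) = 0 := by
    have := congrArg (fun R => Polynomial.coeff R (m - 1)) hPQ
    simp only [hP, Polynomial.comp_C_mul_X_coeff] at this
    exact (mul_eq_zero.mp this.symm).resolve_right (pow_ne_zero _ hc)
  rw [Polynomial.taylor_coeff] at h0
  have hH : Polynomial.hasseDeriv (m - 1) Q = Polynomial.C (m * Q.coeff m) * Polynomial.X := by
    ext n
    rw [Polynomial.hasseDeriv_coeff, Polynomial.coeff_C_mul, Polynomial.coeff_X]
    rcases n with _ | _ | n
    · simp [hQ]
    · have : 0 + 1 + (m - 1) = m := by omega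
      have h2 : m.choose (m - 1) = m := by
        rw [Nat.choose_symm (by omega : 1 ≤ m), Nat.choose_one_right]
      simp [this, h2]
    · rw [Polynomial.coeff_eq_zero_of_natDegree_lt (by omega)]
      simp
  rw [hH] at h0
  simpa [hQm, hm.ne'] using h0

/-- A nonzero weighted homogeneous polynomial which is not a monomial is a `quasiForm`. -/
lemma exists_quasiForm {p q : ℕ} (hp : 1 < p) (hpq : p < q) (hgcd : Nat.gcd p q = 1)
    {f : MvPolynomial (Fin 2) ℝ} (hf0 : f ≠ 0) {d : ℕ}
    (hf : MvPolynomial.IsWeightedHomogeneous (fun i : Fin 2 => if i = 0 then q else p) f d)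
    (hfm : ¬ ∃ (A : ℝ) (k l : ℕ), ∀ x y : ℝ,
      MvPolynomial.eval ![x, y] f = A * x ^ k * y ^ l) :
    ∃ (m b : ℕ) (a : ℕ → ℝ), a 0 ≠ 0 ∧
      (∃ k ∈ Finset.range (m / p + 1), k ≠ 0 ∧ a k ≠ 0) ∧
      ∀ x y, MvPolynomial.eval ![x, y] f = quasiForm p q m b a x y := by
  have hw : ∀ e ∈ f.support, q * e 0 + p * e 1 = d := by
    intro e he
    have := hf (MvPolynomial.mem_support_iff.mp he)
    rw [Finsupp.weight_apply, Finsupp.sum_fintype _ _ (by simp)] at this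
    simpa [Fin.sum_univ_two, mul_comm] using this
  obtain ⟨e₀, he₀, hmax⟩ := Finset.exists_max_image f.support (fun e => e 0)
    (by simpa using hf0)
  set m := e₀ 0
  set b := e₀ 1
  let E : ℕ → (Fin 2 →₀ ℕ) := fun k => Finsupp.single 0 (m - p * k) + Finsupp.single 1 (b + q * k)
  have hE0 : ∀ k, E k 0 = m - p * k := fun k => by simp [E]
  have hE1 : ∀ k, E k 1 = b + q * k := fun k => by simp [E]
  have hinj : Set.InjOn E (Finset.range (m / p + 1) : Finset ℕ) := by
    intro k _ j _ h
    have h1 : E k 1 = E j 1 := by rw [h]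
    rw [hE1, hE1] at h1
    exact Nat.eq_of_mul_eq_mul_left (by omega : 0 < q) (by omega)
  have hsub : f.support ⊆ (Finset.range (m / p + 1)).image E := by
    intro e he
    have h1 := hw e he
    have h2 := hw e₀ he₀
    have h3 : e 0 ≤ m := hmax e he
    obtain ⟨r, hr⟩ := Nat.exists_eq_add_of_le h3
    have h4 : p * e 1 = p * b + q * r := by
      have : q * m = q * e 0 + q * r := by rw [hr]; ring
      change q * m + p * b = d at h2
      omega
    have h5 : p ∣ r := by
      have : p ∣ q * r := (Nat.dvd_add_right (dvd_mul_right p b)).mp ⟨e 1, h4.symm⟩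
      exact Nat.Coprime.dvd_of_dvd_mul_left hgcd this
    obtain ⟨k, rfl⟩ := h5
    have h6 : e 1 = b + q * k :=
      Nat.eq_of_mul_eq_mul_left (by omega : 0 < p) (by rw [h4]; ring)
    refine Finset.mem_image.mpr ⟨k, ?_, ?_⟩
    · rw [Finset.mem_range, Nat.lt_succ_iff, Nat.le_div_iff_mul_le (by omega)]
      rw [mul_comm]; omega
    · ext i
      fin_cases i
      · change E k 0 = e 0
        rw [hE0]; omega
      · change E k 1 = e 1
        rw [hE1, h6]
  have hev : ∀ x y, MvPolynomial.eval ![x, y] f =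
      quasiForm p q m b (fun k => f.coeff (E k)) x y := by
    intro x y
    rw [MvPolynomial.eval_eq', Finset.sum_subset hsub, Finset.sum_image hinj]
    · refine Finset.sum_congr rfl fun k _ => ?_
      simp [Fin.prod_univ_two, hE0, hE1, mul_assoc]
    · intro e _ he
      simp [MvPolynomial.notMem_support_iff.mp he]
  refine ⟨m, b, fun k => f.coeff (E k), ?_, ?_, hev⟩
  · have : E 0 = e₀ := by
      ext i
      fin_cases i
      · exact hE0 0
      · exact hE1 0
    simpa [this] using he₀
  · by_contra! hall
    refine hfm ⟨f.coeff (E 0), m, b, fun x y => ?_⟩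
    rw [hev, quasiForm, Finset.sum_eq_single 0]
    · simp
    · intro k hk hk0
      simp [hall k hk hk0]
    · simp

lemma tendsto_sum_mul_pow {n r : ℕ} (hr : 0 < r) {c : ℕ → ℝ → ℝ} {l : ℕ → ℝ}
    (hc : ∀ k, Tendsto (c k) (𝓝[>] 0) (𝓝 (l k))) :
    Tendsto (fun t => ∑ k ∈ Finset.range (n + 1), c k t * t ^ (r * k)) (𝓝[>] 0) (𝓝 (l 0)) := by
  have hid : Tendsto (fun t : ℝ => t) (𝓝[>] 0) (𝓝 0) := nhdsWithin_le_nhds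
  have h := tendsto_finsetSum (Finset.range (n + 1)) fun k _ => (hc k).mul (hid.pow (r * k))
  have hs : ∑ k ∈ Finset.range (n + 1), l k * 0 ^ (r * k) = l 0 := by
    rw [Finset.sum_eq_single 0]
    · simp
    · intro k _ hk
      simp [hr.ne', hk]
    · simp
  rwa [hs] at h

lemma tendsto_quasiForm_div_pow {p q m b : ℕ} (hpq : p < q) (a : ℕ → ℝ) {X Y : ℝ → ℝ} {x y : ℝ}
    (hX : Tendsto (fun t => X t / t) (𝓝[>] 0) (𝓝 x))
    (hY : Tendsto (fun t => Y t / t) (𝓝[>] 0) (𝓝 y)) :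
    Tendsto (fun t => quasiForm p q m b a (X t) (Y t) / t ^ (m + b)) (𝓝[>] 0)
      (𝓝 (a 0 * x ^ m * y ^ b)) := by
  obtain ⟨r, rfl⟩ := Nat.exists_eq_add_of_lt hpq
  have h := tendsto_sum_mul_pow (n := m / p) (r := r + 1) (by omega)
    (c := fun k t => a k * (X t / t) ^ (m - p * k) * (Y t / t) ^ (b + (p + r + 1) * k))
    fun k => ((hX.pow (m - p * k)).const_mul (a k)).mul (hY.pow (b + (p + r + 1) * k))
  simp only [mul_zero, Nat.sub_zero, Nat.add_zero] at h
  refine h.congr' ?_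
  filter_upwards [self_mem_nhdsWithin] with t ht
  have ht0 : t ≠ 0 := ne_of_gt ht
  rw [quasiForm, Finset.sum_div]
  refine Finset.sum_congr rfl fun k hk => ?_
  obtain ⟨j, hj⟩ := Nat.exists_eq_add_of_le (mul_le_of_mem_range_div hk)
  rw [show m - p * k = j by omega, hj]
  simp only [div_pow]
  field_simp
  ring

lemma tendsto_quasiForm_swap_div_pow {p q m b : ℕ} (hpq : p < q) (a : ℕ → ℝ) (s : ℝ) :
    Tendsto (fun t => quasiForm p q m b a (t ^ p) (t ^ q * s) / t ^ (q * b + p * m)) (𝓝[>] 0)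
      (𝓝 (a 0 * s ^ b)) := by
  obtain ⟨r, hr⟩ := Nat.exists_eq_add_of_lt (Nat.mul_self_lt_mul_self hpq)
  have h := tendsto_sum_mul_pow (n := m / p) (r := r + 1) (by omega)
    (c := fun k _ => a k * s ^ (b + q * k)) fun k => tendsto_const_nhds
  simp only [mul_zero, Nat.add_zero] at h
  refine h.congr' ?_
  filter_upwards [self_mem_nhdsWithin] with t ht
  have ht0 : t ≠ 0 := ne_of_gt ht
  rw [quasiForm, Finset.sum_div]
  refine Finset.sum_congr rfl fun k hk => ?_
  obtain ⟨j, hj⟩ := Nat.exists_eq_add_of_le (mul_le_of_mem_range_div hk)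
  rw [show m - p * k = j by omega, eq_div_iff (pow_ne_zero _ ht0), mul_pow, ← pow_mul, ← pow_mul]
  have : t ^ ((r + 1) * k) * t ^ (q * b + p * m) = t ^ (p * j) * t ^ (q * (b + q * k)) := by
    rw [← pow_add, ← pow_add]
    congr 1
    calc (r + 1) * k + (q * b + p * m) = (p * p + r + 1) * k + q * b + p * j := by rw [hj]; ring
      _ = _ := by rw [← hr]; ring
  linear_combination (a k * s ^ (b + q * k)) * this

lemma continuous_quasiForm (p q m b : ℕ) (a : ℕ → ℝ) :
    Continuous fun z : ℝ × ℝ => quasiForm p q m b a z.1 z.2 := by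
  unfold quasiForm
  fun_prop

/-- If `quasiForm` stays convergent while the second variable has a nonzero limit, then the first
variable cannot escape to infinity along an ultrafilter. -/
lemma exists_tendsto_of_tendsto_quasiForm {ι : Type*} {F : Ultrafilter ι} {p q m b : ℕ}
    (hp : 0 < p) (hm : 0 < m) {a : ℕ → ℝ} (ha : a 0 ≠ 0) {u v : ι → ℝ} {v₀ L : ℝ} (hv₀ : v₀ ≠ 0)
    (hv : Tendsto v F (𝓝 v₀))
    (h : Tendsto (fun i => quasiForm p q m b a (u i) (v i)) F (𝓝 L)) :
    ∃ α, Tendsto u F (𝓝 α) := by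
  by_cases hF : (F.map u : Filter ℝ) ≤ cocompact ℝ
  · exfalso
    have hu : Tendsto (fun i => (u i)⁻¹) F (𝓝 0) := (tendsto_inv₀_cobounded (α := ℝ)).comp <| by
      rw [Metric.cobounded_eq_cocompact]; exact hF
    have hu0 : ∀ᶠ i in (F : Filter ι), u i ≠ 0 :=
      hF (isCompact_singleton (x := (0 : ℝ))).compl_mem_cocompact
    have h1 : Tendsto (fun i => quasiForm p q m b a (u i) (v i) * (u i)⁻¹ ^ m) F (𝓝 0) := by
      simpa [hm.ne'] using h.mul (hu.pow m)
    have h2 := tendsto_finsetSum (Finset.range (m / p + 1)) fun k _ =>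
      ((hu.pow (p * k)).const_mul (a k)).mul (hv.pow (b + q * k))
    have hs : ∑ k ∈ Finset.range (m / p + 1), a k * 0 ^ (p * k) * v₀ ^ (b + q * k)
        = a 0 * v₀ ^ b := by
      rw [Finset.sum_eq_single 0]
      · simp
      · intro k _ hk
        simp [hp.ne', hk]
      · simp
    rw [hs] at h2
    have h3 := h2.congr' (f₂ := fun i => quasiForm p q m b a (u i) (v i) * (u i)⁻¹ ^ m) <| by
      filter_upwards [hu0] with i hi
      rw [quasiForm, Finset.sum_mul]
      refine Finset.sum_congr rfl fun k hk => ?_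
      obtain ⟨j, hj⟩ := Nat.exists_eq_add_of_le (mul_le_of_mem_range_div hk)
      rw [show m - p * k = j by omega, hj]
      simp only [inv_pow]
      field_simp
      ring
    exact mul_ne_zero ha (pow_ne_zero b hv₀) (tendsto_nhds_unique h3 h1)
  · obtain ⟨s, hs, hsF⟩ := Filter.not_le.mp hF
    obtain ⟨K, hK, hKs⟩ := mem_cocompact.mp hs
    have hKF : K ∈ F.map u := by
      by_contra hKF
      exact hsF (mem_of_superset (Ultrafilter.compl_mem_iff_notMem.mpr hKF) hKs)
    obtain ⟨α, _, hα⟩ := hK.ultrafilter_le_nhds (F.map u) (le_principal_iff.mpr hKF)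
    exact ⟨α, hα⟩

lemma tendsto_pow_nhdsGT_zero {n : ℕ} (hn : 0 < n) :
    Tendsto (fun t : ℝ => t ^ n) (𝓝[>] 0) (𝓝 0) := by
  have : Tendsto (fun t : ℝ => t) (𝓝[>] 0) (𝓝 0) := nhdsWithin_le_nhds
  simpa [hn.ne'] using this.pow n

lemma tendsto_quasiCurve {p q : ℕ} (hp : 0 < p) (hpq : p < q) (s : ℝ) :
    Tendsto (fun t : ℝ => ((t ^ q * s, t ^ p) : ℝ × ℝ)) (𝓝[>] 0) (𝓝 0) := by
  have h := ((tendsto_pow_nhdsGT_zero (hp.trans hpq)).mul_const s).prodMk_nhds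
    (tendsto_pow_nhdsGT_zero hp)
  rwa [zero_mul] at h

lemma tendsto_div_pow_along_quasiCurve {p q : ℕ} (hp : 0 < p) (hpq : p < q) {Y : ℝ × ℝ → ℝ}
    {Y' : ℝ × ℝ →L[ℝ] ℝ} (hY : HasFDerivAt Y Y' 0) (hY0 : Y 0 = 0) (s : ℝ) :
    Tendsto (fun t => Y (t ^ q * s, t ^ p) / t ^ p) (𝓝[>] 0) (𝓝 (Y' (0, 1))) := by
  have h := (hasFDerivWithinAt_univ.mpr hY).lim (l := 𝓝[>] (0 : ℝ)) (c := fun t => (t ^ p)⁻¹)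
    (d := fun t => (t ^ q * s, t ^ p)) (v := (0, 1)) (tendsto_quasiCurve hp hpq s) (by simp) ?_
  · refine h.congr fun t => ?_
    simp [hY0, div_eq_inv_mul]
  · have h1 := ((tendsto_pow_nhdsGT_zero (Nat.sub_pos_of_lt hpq)).mul_const s).prodMk_nhds
      (tendsto_const_nhds (x := (1 : ℝ)))
    rw [zero_mul] at h1
    refine h1.congr' ?_
    filter_upwards [self_mem_nhdsWithin] with t ht
    have ht0 : t ≠ 0 := ne_of_gt ht
    ext
    · simp only [Prod.smul_fst, smul_eq_mul]
      rw [pow_sub₀ t ht0 hpq.le]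
      ring
    · simp [ht0]

lemma tendsto_sub_div_pow_along_quasiCurve {p q : ℕ} (hp : 0 < p) (hpq : p < q) {X : ℝ × ℝ → ℝ}
    {X' : ℝ × ℝ →L[ℝ] ℝ} (hX : HasStrictFDerivAt X X' 0) (s : ℝ) :
    Tendsto (fun t => X (t ^ q * s, t ^ p) / t ^ q - X (0, t ^ p) / t ^ q)
      (𝓝[>] 0) (𝓝 (X' (1, 0) * s)) := by
  have h0 : Tendsto (fun t : ℝ => (((t ^ q * s, t ^ p), (0, t ^ p)) : (ℝ × ℝ) × (ℝ × ℝ)))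
      (𝓝[>] 0) (𝓝 (0, 0)) := by
    refine (tendsto_quasiCurve hp hpq s).prodMk_nhds ?_
    simpa using tendsto_quasiCurve hp hpq 0
  have h1 := hX.isLittleO.comp_tendsto h0
  have h2 : (fun t : ℝ => X (t ^ q * s, t ^ p) - X (0, t ^ p) - X' (1, 0) * s * t ^ q)
      =o[𝓝[>] 0] fun t : ℝ => t ^ q := by
    refine (h1.congr_left fun t => ?_).trans_isBigO ?_
    · have : (((t ^ q * s, t ^ p) : ℝ × ℝ) - (0, t ^ p)) = (t ^ q * s) • ((1, 0) : ℝ × ℝ) := by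
        ext <;> simp
      simp only [Function.comp_apply, this, map_smul, smul_eq_mul]
      ring
    · refine Asymptotics.IsBigO.of_bound |s| (Eventually.of_forall fun t => ?_)
      simp [Prod.norm_def, mul_comm |s|, mul_nonneg]
  have h3 := h2.tendsto_div_nhds_zero.add_const (X' (1, 0) * s)
  rw [zero_add] at h3
  refine h3.congr' ?_
  filter_upwards [self_mem_nhdsWithin] with t ht
  have ht0 : t ≠ 0 := ne_of_gt ht
  field_simp
  ring

/-- Limit along the quasi-homogeneous curves `t ↦ (t ^ q * s, t ^ p)` of a `quasiForm` composed
with a strictly differentiable map germ. -/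
lemma exists_limit_eq_quasiForm {p q m b : ℕ} (hp : 0 < p) (hpq : p < q) (hm : 0 < m) {a : ℕ → ℝ}
    (ha : a 0 ≠ 0) {X Y : ℝ × ℝ → ℝ} {X' Y' : ℝ × ℝ →L[ℝ] ℝ} (hX : HasStrictFDerivAt X X' 0)
    (hY : HasFDerivAt Y Y' 0) (hY0 : Y 0 = 0) (hY' : Y' (0, 1) ≠ 0) {P : ℝ → ℝ}
    (hP : ∀ s, Tendsto (fun t => quasiForm p q m b a (X (t ^ q * s, t ^ p)) (Y (t ^ q * s, t ^ p))
      / t ^ (q * m + p * b)) (𝓝[>] 0) (𝓝 (P s))) :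
    ∃ α, ∀ s, P s = quasiForm p q m b a (α + X' (1, 0) * s) (Y' (0, 1)) := by
  have hYlim := tendsto_div_pow_along_quasiCurve hp hpq hY hY0
  have hXlim := tendsto_sub_div_pow_along_quasiCurve hp hpq hX
  have hform : ∀ s, Tendsto (fun t => quasiForm p q m b a (X (t ^ q * s, t ^ p) / t ^ q)
      (Y (t ^ q * s, t ^ p) / t ^ p)) (𝓝[>] 0) (𝓝 (P s)) := by
    intro s
    refine (hP s).congr' ?_
    filter_upwards [self_mem_nhdsWithin] with t ht
    have ht0 : t ≠ 0 := ne_of_gt ht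
    rw [div_eq_iff (pow_ne_zero _ ht0), mul_comm (quasiForm _ _ _ _ _ _ _), ← quasiForm_smul,
      mul_div_cancel₀ _ (pow_ne_zero _ ht0), mul_div_cancel₀ _ (pow_ne_zero _ ht0)]
  obtain ⟨F, hF⟩ := Ultrafilter.exists_le (𝓝[>] (0 : ℝ))
  obtain ⟨α, hα⟩ := exists_tendsto_of_tendsto_quasiForm hp hm ha hY' ((hYlim 0).mono_left hF)
    ((hform 0).mono_left hF)
  refine ⟨α, fun s => ?_⟩
  have hx : Tendsto (fun t => X (t ^ q * s, t ^ p) / t ^ q) F (𝓝 (α + X' (1, 0) * s)) := by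
    refine (hα.add ((hXlim s).mono_left hF)).congr fun t => ?_
    simp only [mul_zero]
    ring
  have hlim := ((continuous_quasiForm p q m b a).tendsto (α + X' (1, 0) * s, Y' (0, 1))).comp
    (hx.prodMk_nhds ((hYlim s).mono_left hF))
  exact tendsto_nhds_unique ((hform s).mono_left hF) hlim

lemma coeff_eq_of_eval_eq_quasiForm {p q m b : ℕ} (hp : 1 < p) (hm : 0 < m) {a : ℕ → ℝ}
    (ha : a 0 ≠ 0) {P : Polynomial ℝ} (hP : P.coeff (m - 1) = 0) {α c e : ℝ} (hc : c ≠ 0)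
    (he : e ≠ 0) (h : ∀ s, P.eval s = quasiForm p q m b a (α + c * s) e) {k : ℕ}
    (hk : k ∈ Finset.range (m / p + 1)) :
    P.coeff (m - p * k) = a k * e ^ (b + q * k) * c ^ (m - p * k) := by
  have hp0 : 0 < p := by omega
  simp only [quasiForm_eq_eval] at h
  obtain rfl : α = 0 := eq_zero_of_eval_affine hm hc hP (gapPoly_coeff_pred hp hm _)
    (by rw [gapPoly_coeff_top hp0]; exact mul_ne_zero ha (pow_ne_zero _ he))
    (gapPoly_natDegree_le _ _ _) h
  have hPQ : P = (gapPoly p m fun k => a k * e ^ (b + q * k)).comp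
      (Polynomial.C c * Polynomial.X) := Polynomial.funext fun s => by simp [h]
  rw [hPQ, Polynomial.comp_C_mul_X_coeff, gapPoly_coeff hp0 _ hk]

lemma eq_of_forall_mul_pow_eq {A C d e : ℝ} {b n : ℕ} (hA : A ≠ 0) (hC : C ≠ 0) (he : e ≠ 0)
    (h : ∀ y, A * y ^ b = C * (e * y + d) ^ n) : b = n := by
  have hpoly : Polynomial.C A * Polynomial.X ^ b =
      Polynomial.C C * (Polynomial.C e * Polynomial.X + Polynomial.C d) ^ n :=
    Polynomial.funext fun y => by simpa using h y
  have := congrArg Polynomial.natDegree hpoly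
  rwa [Polynomial.natDegree_C_mul_X_pow _ _ hA, Polynomial.natDegree_C_mul hC,
    Polynomial.natDegree_pow, Polynomial.natDegree_linear he, mul_one] at this

/-- A monomial in two variables pulled back to a monomial by an invertible linear map. -/
lemma exponents_of_linear {A B l₁₁ l₁₂ l₂₁ l₂₂ : ℝ} {m b m' b' : ℕ} (hA : A ≠ 0) (hB : B ≠ 0)
    (hm' : 0 < m') (hdeg : m + b = m' + b') (hdet : l₁₁ * l₂₂ - l₁₂ * l₂₁ ≠ 0)
    (h : ∀ x y, A * x ^ m * y ^ b = B * (l₁₁ * x + l₁₂ * y) ^ m' * (l₂₁ * x + l₂₂ * y) ^ b') :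
    (m = m' ∧ b = b' ∧ l₁₁ ≠ 0 ∧ l₂₂ ≠ 0) ∨ (m = b' ∧ b = m' ∧ l₁₂ ≠ 0 ∧ l₂₁ ≠ 0) := by
  have hker := h l₁₂ (-l₁₁)
  rw [show l₁₁ * l₁₂ + l₁₂ * -l₁₁ = 0 by ring, zero_pow hm'.ne', mul_zero, zero_mul] at hker
  have hcases : l₁₂ = 0 ∨ l₁₁ = 0 := by
    rcases mul_eq_zero.mp hker with h1 | h1
    · exact .inl (eq_zero_of_pow_eq_zero ((mul_eq_zero.mp h1).resolve_left hA))
    · exact .inr (neg_eq_zero.mp (eq_zero_of_pow_eq_zero h1))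
  rcases hcases with rfl | rfl
  · have h₁₁ : l₁₁ ≠ 0 := by rintro rfl; simp at hdet
    have h₂₂ : l₂₂ ≠ 0 := by rintro rfl; simp at hdet
    have hb : b = b' := eq_of_forall_mul_pow_eq (d := l₂₁) hA
      (mul_ne_zero hB (pow_ne_zero m' h₁₁)) h₂₂ fun y => by
        simpa [add_comm] using h 1 y
    exact .inl ⟨by omega, hb, h₁₁, h₂₂⟩
  · have h₁₂ : l₁₂ ≠ 0 := by rintro rfl; simp at hdet
    have h₂₁ : l₂₁ ≠ 0 := by rintro rfl; simp at hdet
    have hmb : m = b' := eq_of_forall_mul_pow_eq (d := l₂₂) hA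
      (mul_ne_zero hB (pow_ne_zero m' h₁₂)) h₂₁ fun x => by
        simpa using h x 1
    exact .inr ⟨hmb, by omega, h₁₂, h₂₁⟩

lemma eq_zero_of_tendsto_div_pow {N : ℝ → ℝ} {i j : ℕ} (hij : i < j) {A B : ℝ}
    (hA : Tendsto (fun t => N t / t ^ i) (𝓝[>] 0) (𝓝 A))
    (hB : Tendsto (fun t => N t / t ^ j) (𝓝[>] 0) (𝓝 B)) : A = 0 := by
  have h := hB.mul (tendsto_pow_nhdsGT_zero (Nat.sub_pos_of_lt hij))
  rw [mul_zero] at h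
  refine tendsto_nhds_unique (hA.congr' ?_) h
  filter_upwards [self_mem_nhdsWithin] with t ht
  have ht0 : t ≠ 0 := ne_of_gt ht
  rw [pow_sub₀ t ht0 hij.le]
  field_simp

lemma tendsto_smul_div {X : ℝ × ℝ → ℝ} {X' : ℝ × ℝ →L[ℝ] ℝ} (hX : HasFDerivAt X X' 0)
    (hX0 : X 0 = 0) (x y : ℝ) :
    Tendsto (fun t : ℝ => X (t * x, t * y) / t) (𝓝[>] 0)
      (𝓝 (X' (1, 0) * x + X' (0, 1) * y)) := by
  have hv : X' (x, y) = X' (1, 0) * x + X' (0, 1) * y := by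
    have : ((x, y) : ℝ × ℝ) = x • (1, 0) + y • (0, 1) := by ext <;> simp
    rw [this, map_add, map_smul, map_smul, smul_eq_mul, smul_eq_mul]
    ring
  rw [← hv]
  refine ((hX.lim_real (x, y)).comp tendsto_inv_nhdsGT_zero).congr fun t => ?_
  simp [hX0, div_eq_inv_mul]

/-- Comparison of the lowest order homogeneous parts of two `quasiForm`s related by a map germ
with invertible derivative. -/
lemma exponents_of_eventuallyEq {p q m b m' b' : ℕ} (hpq : p < q) (hm' : 0 < m') {a a' : ℕ → ℝ}
    (ha : a 0 ≠ 0) (ha' : a' 0 ≠ 0) {X Y : ℝ × ℝ → ℝ} {X' Y' : ℝ × ℝ →L[ℝ] ℝ}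
    (hX : HasFDerivAt X X' 0) (hY : HasFDerivAt Y Y' 0) (hX0 : X 0 = 0) (hY0 : Y 0 = 0)
    (hdet : X' (1, 0) * Y' (0, 1) - X' (0, 1) * Y' (1, 0) ≠ 0)
    (h : ∀ᶠ z in 𝓝 (0 : ℝ × ℝ), quasiForm p q m b a z.1 z.2 = quasiForm p q m' b' a' (X z) (Y z)) :
    (m = m' ∧ b = b' ∧ X' (1, 0) ≠ 0 ∧ Y' (0, 1) ≠ 0) ∨
      (m = b' ∧ b = m' ∧ X' (0, 1) ≠ 0 ∧ Y' (1, 0) ≠ 0) := by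
  have hleft : ∀ x y : ℝ, Tendsto (fun t => quasiForm p q m b a (t * x) (t * y) / t ^ (m + b))
      (𝓝[>] 0) (𝓝 (a 0 * x ^ m * y ^ b)) := fun x y => by
    have hc : ∀ x : ℝ, Tendsto (fun t : ℝ => t * x / t) (𝓝[>] 0) (𝓝 x) := fun x => by
      refine tendsto_const_nhds.congr' ?_
      filter_upwards [self_mem_nhdsWithin] with t ht
      exact (mul_div_cancel_left₀ x (ne_of_gt ht)).symm
    exact tendsto_quasiForm_div_pow hpq a (hc x) (hc y)
  have hright : ∀ x y : ℝ, Tendsto (fun t => quasiForm p q m b a (t * x) (t * y) / t ^ (m' + b'))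
      (𝓝[>] 0) (𝓝 (a' 0 * (X' (1, 0) * x + X' (0, 1) * y) ^ m' *
        (Y' (1, 0) * x + Y' (0, 1) * y) ^ b')) := fun x y => by
    refine (tendsto_quasiForm_div_pow hpq a' (tendsto_smul_div hX hX0 x y)
      (tendsto_smul_div hY hY0 x y)).congr' ?_
    have hid : Tendsto (fun t : ℝ => t) (𝓝[>] 0) (𝓝 0) := nhdsWithin_le_nhds
    have hz : Tendsto (fun t : ℝ => ((t * x, t * y) : ℝ × ℝ)) (𝓝[>] 0) (𝓝 0) := by
      have := (hid.mul_const x).prodMk_nhds (hid.mul_const y)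
      rwa [zero_mul, zero_mul] at this
    filter_upwards [hz.eventually h] with t ht
    rw [ht]
  have hdeg : m + b = m' + b' := by
    rcases lt_trichotomy (m + b) (m' + b') with hlt | heq | hlt
    · have := eq_zero_of_tendsto_div_pow hlt (hleft 1 1) (hright 1 1)
      simp [ha] at this
    · exact heq
    · have := eq_zero_of_tendsto_div_pow hlt
        (hright (Y' (0, 1) - X' (0, 1)) (X' (1, 0) - Y' (1, 0)))
        (hleft (Y' (0, 1) - X' (0, 1)) (X' (1, 0) - Y' (1, 0)))
      rw [show X' (1, 0) * (Y' (0, 1) - X' (0, 1)) + X' (0, 1) * (X' (1, 0) - Y' (1, 0)) =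
          X' (1, 0) * Y' (0, 1) - X' (0, 1) * Y' (1, 0) by ring,
        show Y' (1, 0) * (Y' (0, 1) - X' (0, 1)) + Y' (0, 1) * (X' (1, 0) - Y' (1, 0)) =
          X' (1, 0) * Y' (0, 1) - X' (0, 1) * Y' (1, 0) by ring] at this
      exact absurd this
        (mul_ne_zero (mul_ne_zero ha' (pow_ne_zero _ hdet)) (pow_ne_zero _ hdet))
  refine exponents_of_linear ha ha' hm' hdeg hdet fun x y =>
    tendsto_nhds_unique (hleft x y) ?_
  rw [hdeg]
  exact hright x y

/-- A `C¹` diffeomorphism germ of the plane has strictly differentiable components with nonzero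
Jacobian determinant. -/
lemma IsC1DiffeoGerm.exists_hasStrictFDerivAt {σ : ℝ × ℝ → ℝ × ℝ} (hσ : IsC1DiffeoGerm σ) :
    ∃ X' Y' : ℝ × ℝ →L[ℝ] ℝ, HasStrictFDerivAt (fun z => (σ z).1) X' 0 ∧
      HasStrictFDerivAt (fun z => (σ z).2) Y' 0 ∧
      X' (1, 0) * Y' (0, 1) - X' (0, 1) * Y' (1, 0) ≠ 0 := by
  obtain ⟨h0, U, V, τ, hU, hV, h0U, h0V, -, -, hτσ, -, hσU, hτV⟩ := hσ
  have hS := (hσU.contDiffAt (hU.mem_nhds h0U)).hasStrictFDerivAt one_ne_zero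
  have hT := (hτV.contDiffAt (hV.mem_nhds h0V)).hasStrictFDerivAt one_ne_zero
  set S := fderiv ℝ σ 0
  set T := fderiv ℝ τ 0
  have hTS : T.comp S = ContinuousLinearMap.id ℝ (ℝ × ℝ) := by
    have h1 : HasFDerivAt (τ ∘ σ) (T.comp S) 0 :=
      HasFDerivAt.comp 0 (by rw [h0]; exact hT.hasFDerivAt) hS.hasFDerivAt
    refine h1.unique ((hasFDerivAt_id (𝕜 := ℝ) (0 : ℝ × ℝ)).congr_of_eventuallyEq ?_)
    filter_upwards [hU.mem_nhds h0U] with z hz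
    exact hτσ z hz
  have hinj : ∀ v, S v = 0 → v = 0 := fun v hv => by
    have := congrArg (fun R : ℝ × ℝ →L[ℝ] ℝ × ℝ => R v) hTS
    simpa [hv] using this.symm
  have hSxy : ∀ x y : ℝ, S (x, y) = x • S (1, 0) + y • S (0, 1) := fun x y => by
    rw [← map_smul, ← map_smul, ← map_add]
    simp
  refine ⟨(ContinuousLinearMap.fst ℝ ℝ ℝ).comp S, (ContinuousLinearMap.snd ℝ ℝ ℝ).comp S,
    hasStrictFDerivAt_fst.comp 0 hS, hasStrictFDerivAt_snd.comp 0 hS, fun hdet => ?_⟩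
  simp only [ContinuousLinearMap.comp_apply, ContinuousLinearMap.coe_fst',
    ContinuousLinearMap.coe_snd'] at hdet
  have h1 := hinj ((S (0, 1)).2, -(S (1, 0)).2) <| by
    rw [hSxy]
    ext
    · simp only [Prod.fst_add, Prod.smul_fst, smul_eq_mul, Prod.fst_zero]
      linear_combination hdet
    · simp only [Prod.snd_add, Prod.smul_snd, smul_eq_mul, Prod.snd_zero]
      ring
  have h2 := hinj ((S (0, 1)).1, -(S (1, 0)).1) <| by
    rw [hSxy]
    ext
    · simp only [Prod.fst_add, Prod.smul_fst, smul_eq_mul, Prod.fst_zero]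
      ring
    · simp only [Prod.snd_add, Prod.smul_snd, smul_eq_mul, Prod.snd_zero]
      linear_combination -hdet
  have h3 := hinj (1, 0) <| by
    ext
    · simpa using congrArg Prod.snd h2
    · simpa using congrArg Prod.snd h1
  simpa using congrArg Prod.fst h3

/-- Classification of C¹ equivalent weighted homogeneous polynomials, case of weights
`(q, p)` with `1 < p < q`, `gcd(p,q) = 1`, and `f`, `g` not monomials. -/
theorem stmt14 (p q : ℕ) (hp : 1 < p) (hpq : p < q) (hgcd : Nat.gcd p q = 1)
    (f g : MvPolynomial (Fin 2) ℝ) (hf0 : f ≠ 0) (hg0 : g ≠ 0) (df dg : ℕ)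
    (hf : MvPolynomial.IsWeightedHomogeneous (fun i : Fin 2 => if i = 0 then q else p) f df)
    (hg : MvPolynomial.IsWeightedHomogeneous (fun i : Fin 2 => if i = 0 then q else p) g dg)
    (hfm : ¬ ∃ (A : ℝ) (k l : ℕ), ∀ x y : ℝ,
      MvPolynomial.eval ![x, y] f = A * x ^ k * y ^ l)
    (hgm : ¬ ∃ (A : ℝ) (k l : ℕ), ∀ x y : ℝ,
      MvPolynomial.eval ![x, y] g = A * x ^ k * y ^ l)
    (σ : ℝ × ℝ → ℝ × ℝ) (hσ : IsC1DiffeoGerm σ)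
    (hfg : ∀ᶠ p' in 𝓝 (0 : ℝ × ℝ),
      MvPolynomial.eval ![p'.1, p'.2] f = MvPolynomial.eval ![(σ p').1, (σ p').2] g) :
    ∃ c₁ c₂ : ℝ, c₁ ≠ 0 ∧ c₂ ≠ 0 ∧ ∀ x y : ℝ,
      MvPolynomial.eval ![x, y] f = MvPolynomial.eval ![c₁ * x, c₂ * y] g := by
  obtain ⟨m, b, a, ha, -, hfa⟩ := exists_quasiForm hp hpq hgcd hf0 hf hfm
  obtain ⟨m', b', a', ha', ⟨k, hk, hk0, hak⟩, hga⟩ := exists_quasiForm hp hpq hgcd hg0 hg hgm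
  have hp0 : 0 < p := by omega
  have hm' : 0 < m' := (Nat.mul_pos hp0 (Nat.pos_of_ne_zero hk0)).trans_le
    (mul_le_of_mem_range_div hk)
  obtain ⟨X', Y', hX, hY, hdet⟩ := hσ.exists_hasStrictFDerivAt
  have hX0 : (σ 0).1 = 0 := by simp [hσ.1]
  have hY0 : (σ 0).2 = 0 := by simp [hσ.1]
  simp only [hfa, hga] at hfg ⊢
  rcases exponents_of_eventuallyEq hpq hm' ha ha' hX.hasFDerivAt hY.hasFDerivAt hX0 hY0 hdet hfg
    with ⟨rfl, rfl, hc₁, hc₂⟩ | ⟨rfl, rfl, hc₁, hc₂⟩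
  · obtain ⟨α, hα⟩ := exists_limit_eq_quasiForm hp0 hpq hm' ha' hX hY.hasFDerivAt hY0 hc₂
      (P := fun s => quasiForm p q m b a s 1) fun s => by
        refine tendsto_const_nhds.congr' ?_
        filter_upwards [self_mem_nhdsWithin, (tendsto_quasiCurve hp0 hpq s).eventually hfg]
          with t ht heq
        rw [← heq, eq_div_iff (pow_ne_zero _ (ne_of_gt ht)), mul_comm, ← quasiForm_smul, mul_one]
    simp only [quasiForm_eq_eval p q m b a] at hα
    refine ⟨X' (1, 0), Y' (0, 1), hc₁, hc₂, fun x y => Finset.sum_congr rfl fun k hk => ?_⟩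
    have hcoeff := coeff_eq_of_eval_eq_quasiForm hp hm' ha' (gapPoly_coeff_pred hp hm' _) hc₁ hc₂
      hα hk
    rw [gapPoly_coeff hp0 _ hk, one_pow, mul_one] at hcoeff
    rw [hcoeff]
    ring
  · exfalso
    let e : (ℝ × ℝ) →L[ℝ] (ℝ × ℝ) :=
      (ContinuousLinearMap.snd ℝ ℝ ℝ).prod (ContinuousLinearMap.fst ℝ ℝ ℝ)
    have hXe : HasStrictFDerivAt (fun z => (σ (e z)).1) (X'.comp e) 0 :=
      HasStrictFDerivAt.comp (g := fun z => (σ z).1) 0 (by simpa using hX) e.hasStrictFDerivAt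
    have hYe : HasStrictFDerivAt (fun z => (σ (e z)).2) (Y'.comp e) 0 :=
      HasStrictFDerivAt.comp (g := fun z => (σ z).2) 0 (by simpa using hY) e.hasStrictFDerivAt
    obtain ⟨α, hα⟩ := exists_limit_eq_quasiForm (b := m) hp0 hpq hm' ha' hXe hYe.hasFDerivAt
      (by simpa using hY0) (by simpa [e] using hc₂)
      (P := fun s => a 0 * s ^ b) fun s => by
        refine (tendsto_quasiForm_swap_div_pow (m := m) hpq a s).congr' ?_
        have hz := (e.continuous.tendsto 0).comp (tendsto_quasiCurve hp0 hpq s)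
        rw [map_zero] at hz
        filter_upwards [hz.eventually hfg] with t heq
        exact congrArg (· / t ^ (q * b + p * m)) heq
    have hcoeff := coeff_eq_of_eval_eq_quasiForm (P := Polynomial.monomial b (a 0)) (e := Y' (1, 0))
      (c := X' (0, 1)) (α := α) hp hm' ha'
      (by rw [Polynomial.coeff_monomial, if_neg (by omega)]) hc₁ hc₂
      (fun s => by simpa [e] using hα s) hk
    have hpk : 0 < p * k := Nat.mul_pos hp0 (Nat.pos_of_ne_zero hk0)
    rw [Polynomial.coeff_monomial, if_neg (by omega)] at hcoeff
    exact mul_ne_zero (mul_ne_zero hak (pow_ne_zero _ hc₂)) (pow_ne_zero _ hc₁) hcoeff.symm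
end
end
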